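/- arXiv:2203.01410 — 2 statements merged into one kernel-verified Lean document; each statement's English description precedes it below -/
import Mathlib

section
/- Let A be the 6×6 real matrix with rows (0,1,0,0,0,0), (1.000002542612694, 0, 0, 2, 0, 0), (0,0,0,1,0,0), (0, -0.000294117647059, 0, 0, 0, 0), (0,0,0,0,0,1), (0,0,0,0,-0.00000127311747,0), and let B be the 6×1 column vector (0,0,0,1,0,0)ᵀ (a single thruster in the tangential θ-direction). Then the Kalman controllability matrix Q = [B, AB, A²B, A³B, A⁴B, A⁵B], viewed as a 6×6 real matrix, has rank 4; in particular its rank is strictly less than 6. -/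
/-- Linearized satellite dynamics matrix under the `J₂` zonal harmonic. -/
def A : Matrix (Fin 6) (Fin 6) ℝ :=
  !![0, 1, 0, 0, 0, 0;
     1.000002542612694, 0, 0, 2, 0, 0;
     0, 0, 0, 1, 0, 0;
     0, -0.000294117647059, 0, 0, 0, 0;
     0, 0, 0, 0, 0, 1;
     0, 0, 0, 0, -0.00000127311747, 0]

/-- Input matrix: thruster columns. -/
def B : Matrix (Fin 6) (Fin 1) ℝ :=
  !![0;
     0;
     0;
     1;
     0;
     0]

/-- Kalman controllability matrix `Q = [B, AB, A²B, A³B, A⁴B, A⁵B]`,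
viewed as a `6 × 6` real matrix with columns indexed by `Fin 6 × Fin 1`. -/
def Q : Matrix (Fin 6) (Fin 6 × Fin 1) ℝ :=
  Matrix.of fun i p => (A ^ (p.1 : ℕ) * B) i p.2

theorem Q_eq_submatrix (a c : ℝ) (ha : a = 1.000002542612694) (hc : c = 0.000294117647059) :
    Q = (!![0, 0, 2, 0, 2 * (a - 2 * c), 0;
            0, 2, 0, 2 * (a - 2 * c), 0, 2 * (a - 2 * c) * (a - 2 * c);
            0, 1, 0, -2 * c, 0, -2 * c * (a - 2 * c);
            1, 0, -2 * c, 0, -2 * c * (a - 2 * c), 0;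
            0, 0, 0, 0, 0, 0;
            0, 0, 0, 0, 0, 0] : Matrix (Fin 6) (Fin 6) ℝ).submatrix id Prod.fst := by
  have h0 : A ^ 0 * B = !![0; 0; 0; 1; 0; 0] := by rw [pow_zero, Matrix.one_mul, B]
  have h1 : A ^ 1 * B = !![0; 2; 1; 0; 0; 0] := by
    rw [pow_succ', Matrix.mul_assoc, h0]
    ext i j
    fin_cases i <;> simp [A, Matrix.mul_apply, Fin.sum_univ_succ]
  have h2 : A ^ 2 * B = !![2; 0; 0; -2 * c; 0; 0] := by
    rw [pow_succ', Matrix.mul_assoc, h1]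
    ext i j
    fin_cases i <;> simp [A, Matrix.mul_apply, Fin.sum_univ_succ, ← hc, mul_comm]
  have h3 : A ^ 3 * B = !![0; 2 * (a - 2 * c); -2 * c; 0; 0; 0] := by
    rw [pow_succ', Matrix.mul_assoc, h2]
    ext i j
    fin_cases i <;> simp [A, Matrix.mul_apply, Fin.sum_univ_succ, ← ha]
    ring
  have h4 : A ^ 4 * B = !![2 * (a - 2 * c); 0; 0; -2 * c * (a - 2 * c); 0; 0] := by
    rw [pow_succ', Matrix.mul_assoc, h3]
    ext i j
    fin_cases i <;> simp [A, Matrix.mul_apply, Fin.sum_univ_succ, ← hc]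
    ring
  have h5 : A ^ 5 * B =
      !![0; 2 * (a - 2 * c) * (a - 2 * c); -2 * c * (a - 2 * c); 0; 0; 0] := by
    rw [pow_succ', Matrix.mul_assoc, h4]
    ext i j
    fin_cases i <;> simp [A, Matrix.mul_apply, Fin.sum_univ_succ, ← ha]
    ring
  ext i ⟨k, l⟩
  fin_cases l
  change (A ^ (k : ℕ) * B) i 0 = _
  fin_cases k <;> dsimp only <;> simp only [h0, h1, h2, h3, h4, h5] <;> fin_cases i <;> rfl

theorem kalman_rank_theta : Q.rank = 4 ∧ Q.rank < 6 := by
  suffices h : Q.rank = 4 by omega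
  obtain ⟨a, ha⟩ : ∃ a : ℝ, a = 1.000002542612694 := ⟨_, rfl⟩
  obtain ⟨c, hc⟩ : ∃ c : ℝ, c = 0.000294117647059 := ⟨_, rfl⟩
  rw [Q_eq_submatrix a c ha hc]
  apply le_antisymm
  · refine (Matrix.rank_submatrix_le _ _ _).trans ?_
    refine le_trans (le_of_eq (congrArg Matrix.rank ?_)) ((Matrix.rank_mul_le_left
      (!![0, 0, 2, 0;
          0, 2, 0, 2 * (a - 2 * c);
          0, 1, 0, -2 * c;
          1, 0, -2 * c, 0;
          0, 0, 0, 0;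
          0, 0, 0, 0] : Matrix (Fin 6) (Fin 4) ℝ)
      (!![1, 0, 0, 0, 0, 0;
          0, 1, 0, 0, 0, 0;
          0, 0, 1, 0, a - 2 * c, 0;
          0, 0, 0, 1, 0, a - 2 * c] : Matrix (Fin 4) (Fin 6) ℝ)).trans (Matrix.rank_le_width _))
    simp
  · have hdet : (!![0, 0, 2, 0;
                    0, 2, 0, 2 * (a - 2 * c);
                    0, 1, 0, -2 * c;
                    1, 0, -2 * c, 0] : Matrix (Fin 4) (Fin 4) ℝ).det = -4 * a := by
      simp [Matrix.det_succ_row_zero, Fin.sum_univ_succ, Fin.succAbove]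
      ring
    have hunit := (Matrix.isUnit_iff_isUnit_det _).2
      (hdet ▸ (by rw [ha]; norm_num : (-4 * a) ≠ 0).isUnit)
    have hrank := Matrix.rank_of_isUnit _ hunit
    rw [Fintype.card_fin] at hrank
    refine hrank.symm.le.trans (le_trans (le_of_eq (congrArg Matrix.rank ?_))
      (Matrix.rank_submatrix_le _
      (Fin.castLE (by norm_num) : Fin 4 → Fin 6)
      (fun j : Fin 4 => (Fin.castLE (by norm_num) j, 0))))
    ext i j
    fin_cases i <;> fin_cases j <;> rfl
end

section
/- Let A be the 6×6 real matrix with rows (0,1,0,0,0,0), (1.000002542612694, 0, 0, 2, 0, 0), (0,0,0,1,0,0), (0, -0.000294117647059, 0, 0, 0, 0), (0,0,0,0,0,1), (0,0,0,0,-0.00000127311747,0), and let B be the 6×1 column vector (0,0,0,1,0,0)ᵀ (a single thruster in the tangential θ-direction). Then the linear control system ẋ(t) = A x(t) + B u(t) is not controllable: for every t₀ < t₁ in ℝ there exists a target state x₁ ∈ ℝ⁶ such that for every continuous control u : ℝ → ℝ and every differentiable trajectory x : ℝ → ℝ⁶ satisfying x′(t) = A x(t) + B u(t) for all t and x(t₀)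 = 0, one has x(t₁) ≠ x₁. -/
/-- The out-of-plane energy is conserved by every controlled trajectory, since the tangential
thruster does not act on the out-of-plane coordinates. -/
theorem hasDerivAt_outOfPlaneEnergy {u : ℝ → ℝ} {x : ℝ → Fin 6 → ℝ} {t : ℝ}
    (hx : HasDerivAt x (A.mulVec (x t) + B.mulVec (fun _ => u t)) t) :
    HasDerivAt (fun s => 0.00000127311747 * x s 4 ^ 2 + x s 5 ^ 2) 0 t := by
  have h := hasDerivAt_pi.1 hx
  have h4 : HasDerivAt (fun s => x s 4) (x t 5) t := by
    simpa [A, B, Matrix.mulVec, dotProduct, Fin.sum_univ_succ] using h 4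
  have h5 : HasDerivAt (fun s => x s 5) (-0.00000127311747 * x t 4) t := by
    refine (h 5).congr_deriv ?_
    simp [A, B, dotProduct, Fin.sum_univ_succ]
  refine (((h4.pow 2).const_mul 0.00000127311747).add (h5.pow 2)).congr_deriv ?_
  push_cast
  ring

theorem not_controllable_theta :
    ∀ t₀ t₁ : ℝ, t₀ < t₁ →
      ∃ x₁ : Fin 6 → ℝ, ∀ u : ℝ → ℝ, Continuous u →
        ∀ x : ℝ → Fin 6 → ℝ,
          (∀ t : ℝ, HasDerivAt x (A.mulVec (x t) + B.mulVec (fun _ => u t)) t) →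
          x t₀ = 0 → x t₁ ≠ x₁ := by
  intro t₀ t₁ _
  refine ⟨fun _ => 1, fun u _ x hx h₀ h₁ => ?_⟩
  have hE := fun t => hasDerivAt_outOfPlaneEnergy (hx t)
  have h := is_const_of_deriv_eq_zero (fun t => (hE t).differentiableAt)
    (fun t => (hE t).deriv) t₀ t₁
  norm_num [h₀, h₁] at h
end
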